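/- arXiv:2404.02498 — 8 statements merged into one kernel-verified Lean document; each statement's English description precedes it below -/
import Mathlib

section
/- If (1−β)c ≤ βk, then for every time t with 0 ≤ t ≤ T and every randomized stopping plan p at time t, the plan δ₀ that stops immediately (δ₀ has p_0 = 1 and p_j = 0 for j ≥ 1) satisfies V_t(δ₀) ≥ V_t(p). In other words, stopping immediately is optimal at every time. -/
/-- Present-biased preference value with immediate cost: for a randomized stopping plan
`p = (p 0, …, p (T-t))` at time `t`,
`V_t(p) = (βv − c)·p 0 + Σ_{j=1}^{T−t} β(v − jk − c)·p j − βtk`. -/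
noncomputable def costVal (T : ℕ) (v c k β : ℝ) (t : ℕ) (p : ℕ → ℝ) : ℝ :=
  (β * v - c) * p 0 + (∑ j ∈ Finset.Icc 1 (T - t), β * (v - (j : ℝ) * k - c) * p j)
    - β * (t : ℝ) * k

/-- Fix `T ≥ 1` and reals `v, c, k, β` with `0 < β ≤ 1`, `k > 0`, `c > 0`, `T·k < v`.
If `(1−β)c ≤ βk`, then for every time `0 ≤ t ≤ T` and every randomized stopping plan `p`
at time `t` (`p j ≥ 0` for `j ≤ T−t` and `Σ_{j=0}^{T−t} p j = 1`), the plan `δ₀` that stops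
immediately satisfies `V_t(δ₀) ≥ V_t(p)`: stopping immediately is optimal at every time. -/
theorem immediate_cost_stop_now_optimal
    (T : ℕ) (hT : 1 ≤ T) (v c k β : ℝ)
    (hβ0 : 0 < β) (hβ1 : β ≤ 1) (hk : 0 < k) (hc : 0 < c) (hv : (T : ℝ) * k < v)
    (h : (1 - β) * c ≤ β * k) :
    ∀ t : ℕ, t ≤ T → ∀ p : ℕ → ℝ,
      (∀ j : ℕ, j ≤ T - t → 0 ≤ p j) →
      (∑ j ∈ Finset.range (T - t + 1), p j) = 1 →
      costVal T v c k β t p ≤ costVal T v c k β t (fun j => if j = 0 then 1 else 0) := by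
  intro t _ p hp hsum
  have hsplit : p 0 + ∑ j ∈ Finset.Icc 1 (T - t), p j = 1 := by
    rw [← hsum, Finset.range_eq_Ico, Finset.sum_eq_sum_Ico_succ_bot (Nat.succ_pos _)]
    rfl
  have hdelay : ∑ j ∈ Finset.Icc 1 (T - t), β * (v - (j : ℝ) * k - c) * p j
      ≤ (β * v - c) * ∑ j ∈ Finset.Icc 1 (T - t), p j := by
    rw [Finset.mul_sum]
    refine Finset.sum_le_sum fun j hj => ?_
    obtain ⟨hj1, hjT⟩ := Finset.mem_Icc.mp hj
    refine mul_le_mul_of_nonneg_right ?_ (hp j hjT)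
    have hj1' : (1 : ℝ) ≤ j := by exact_mod_cast hj1
    nlinarith [mul_le_mul_of_nonneg_right hj1' (mul_pos hβ0 hk).le]
  have hnow : ∑ j ∈ Finset.Icc 1 (T - t),
      β * (v - (j : ℝ) * k - c) * (if j = 0 then (1 : ℝ) else 0) = 0 := by
    refine Finset.sum_eq_zero fun j hj => ?_
    rw [if_neg (Nat.one_le_iff_ne_zero.mp (Finset.mem_Icc.mp hj).1), mul_zero]
  rw [costVal, costVal, hnow, if_pos rfl]
  linear_combination hdelay + (β * v - c) * hsplit
end

section
/- If (1−β)c > βk, then for every time t with 0 ≤ t < T, the plan δ₁ that stops at time t+1 for sure (p_1 = 1, all other p_j = 0) satisfies V_t(δ₁) ≥ V_t(p) for every randomized stopping plan p at time t, with equality only when p = δ₁; in particular δ₁ is the unique maximizer of V_t and V_t(δ₁) > V_t(δ₀), so the naive agent never stops before the terminal time T. -/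
/-- The weight that `costVal` puts on stopping `j` periods ahead. -/
noncomputable def stopWeight (v c k β : ℝ) (j : ℕ) : ℝ :=
  if j = 0 then β * v - c else β * (v - (j : ℝ) * k - c)

lemma costVal_eq_sum_stopWeight (T : ℕ) (v c k β : ℝ) (t : ℕ) (p : ℕ → ℝ) :
    costVal T v c k β t p =
      (∑ j ∈ Finset.range (T - t + 1), stopWeight v c k β j * p j) - β * (t : ℝ) * k := by
  have hIcc : Finset.Icc 1 (T - t) = Finset.Ico 1 (T - t + 1) := by
    ext j
    simp only [Finset.mem_Icc, Finset.mem_Ico]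
    omega
  rw [costVal, hIcc, Finset.sum_Ico_eq_sum_range, Finset.sum_range_succ', add_comm (_ * _)]
  simp [stopWeight, add_comm 1]

lemma costVal_dirac {T t : ℕ} (v c k β : ℝ) {m : ℕ} (hm : m ≤ T - t) :
    costVal T v c k β t (fun j => if j = m then 1 else 0) =
      stopWeight v c k β m - β * (t : ℝ) * k := by
  simp [costVal_eq_sum_stopWeight, Nat.lt_succ_of_le hm]

lemma stopWeight_lt_stopWeight_one {v c k β : ℝ} (hβ : 0 < β) (hk : 0 < k)
    (h : β * k < (1 - β) * c) {j : ℕ} (hj : j ≠ 1) :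
    stopWeight v c k β j < stopWeight v c k β 1 := by
  rcases Nat.eq_zero_or_pos j with rfl | hpos
  · simp only [stopWeight, if_true, one_ne_zero, if_false, Nat.cast_one]
    linarith
  · have hj1 : (1 : ℝ) < j := by exact_mod_cast (by omega : 1 < j)
    simp only [stopWeight, hpos.ne', one_ne_zero, if_false, Nat.cast_one]
    gcongr

/-- Fix `T ≥ 1` and reals `v, c, k, β` with `0 < β ≤ 1`, `k > 0`, `c > 0`, `T·k < v`.
If `(1−β)c > βk`, then for every time `0 ≤ t < T`, the plan `δ₁` that stops at time `t+1`
for sure satisfies `V_t(δ₁) ≥ V_t(p)` for every randomized stopping plan `p` at time `t`,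
with equality only when `p = δ₁`; in particular `δ₁` is the unique maximizer of `V_t` and
`V_t(δ₁) > V_t(δ₀)`, so the naive agent never stops before the terminal time `T`. -/
theorem immediate_cost_stop_next_unique
    (T : ℕ) (hT : 1 ≤ T) (v c k β : ℝ)
    (hβ0 : 0 < β) (hβ1 : β ≤ 1) (hk : 0 < k) (hc : 0 < c) (hv : (T : ℝ) * k < v)
    (h : β * k < (1 - β) * c) :
    ∀ t : ℕ, t < T →
      (∀ p : ℕ → ℝ,
        (∀ j : ℕ, j ≤ T - t → 0 ≤ p j) →
        (∑ j ∈ Finset.range (T - t + 1), p j) = 1 →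
        costVal T v c k β t p ≤ costVal T v c k β t (fun j => if j = 1 then 1 else 0) ∧
        (costVal T v c k β t p = costVal T v c k β t (fun j => if j = 1 then 1 else 0) →
          ∀ j : ℕ, j ≤ T - t → p j = if j = 1 then 1 else 0)) ∧
      costVal T v c k β t (fun j => if j = 0 then 1 else 0)
        < costVal T v c k β t (fun j => if j = 1 then 1 else 0) := by
  intro t ht
  have hm : 1 ≤ T - t := by omega
  rw [costVal_dirac v c k β hm, costVal_dirac v c k β (Nat.zero_le _)]
  refine ⟨fun p hp hsum => ?_, by
    linarith [stopWeight_lt_stopWeight_one (v := v) hβ0 hk h zero_ne_one]⟩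
  rw [costVal_eq_sum_stopWeight]
  have hgap : stopWeight v c k β 1 - ∑ j ∈ Finset.range (T - t + 1), stopWeight v c k β j * p j =
      ∑ j ∈ Finset.range (T - t + 1), (stopWeight v c k β 1 - stopWeight v c k β j) * p j := by
    simp only [sub_mul, Finset.sum_sub_distrib, ← Finset.mul_sum, hsum, mul_one]
  have hnonneg : ∀ j ∈ Finset.range (T - t + 1),
      0 ≤ (stopWeight v c k β 1 - stopWeight v c k β j) * p j := by
    intro j hj
    refine mul_nonneg ?_ (hp j (Finset.mem_range_succ_iff.mp hj))
    rcases eq_or_ne j 1 with rfl | hj1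
    · simp
    · exact sub_nonneg.mpr (stopWeight_lt_stopWeight_one hβ0 hk h hj1).le
  refine ⟨by linarith [Finset.sum_nonneg hnonneg], fun heq => ?_⟩
  have hzero : ∀ j ∈ Finset.range (T - t + 1), j ≠ 1 → p j = 0 := by
    intro j hj hj1
    have hterm := (Finset.sum_eq_zero_iff_of_nonneg hnonneg).mp (by linarith) j hj
    exact (mul_eq_zero.mp hterm).resolve_left
      (sub_pos.mpr (stopWeight_lt_stopWeight_one hβ0 hk h hj1)).ne'
  intro j hj
  split_ifs with hj1
  · subst hj1
    rw [← hsum]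
    exact (Finset.sum_eq_single_of_mem 1 (Finset.mem_range_succ_iff.mpr hm) hzero).symm
  · exact hzero j (Finset.mem_range_succ_iff.mpr hj) hj1
end

section
/- The strategy s* defined by s*(t) = 1 if and only if ϱ divides T − t is the unique fixed point of the training operator Φ among pure stopping strategies; this fixed point is the sophisticated strategy of the immediate-cost problem. -/
/-- `nextStop T s t = σ_s(t) = min {u : t < u ≤ T, s u = 1}`, the first stopping time of the
pure stopping strategy `s : {0,…,T} → {0,1}` strictly after time `t`. -/
noncomputable def nextStop (T : ℕ) (s : ℕ → Bool) (t : ℕ) : ℕ :=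
  sInf {u : ℕ | t < u ∧ u ≤ T ∧ s u = true}

/-- The training operator `Φ` of the immediate-cost problem: `Φ(s)(T) = 1` and, for `t < T`,
`Φ(s)(t) = 1` if `σ_s(t) − t ≥ ϱ` and `Φ(s)(t) = 0` otherwise. -/
noncomputable def Phi (T ϱ : ℕ) (s : ℕ → Bool) : ℕ → Bool :=
  fun t => if t < T then decide (ϱ ≤ nextStop T s t - t) else true

/-- If `s` agrees with `s*` strictly after `t`, then `Φ(s)(t) = s*(t)`. -/
theorem Phi_eq_of_agree_after {T ϱ : ℕ} (hϱ : 0 < ϱ) {s : ℕ → Bool} {t : ℕ} (ht : t ≤ T)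
    (hs : ∀ u, t < u → u ≤ T → s u = decide (ϱ ∣ T - u)) :
    Phi T ϱ s t = decide (ϱ ∣ T - t) := by
  rcases ht.eq_or_lt with rfl | hlt
  · simp [Phi]
  have hne : {u : ℕ | t < u ∧ u ≤ T ∧ s u = true}.Nonempty :=
    ⟨T, hlt, le_rfl, by simp [hs T hlt le_rfl]⟩
  obtain ⟨htu, huT, hsu⟩ : t < nextStop T s t ∧ nextStop T s t ≤ T ∧ s (nextStop T s t) = true :=
    Nat.sInf_mem hne
  have hmin : ∀ v, t < v → v ≤ T → ϱ ∣ T - v → nextStop T s t ≤ v := fun v h₁ h₂ h₃ =>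
    Nat.sInf_le ⟨h₁, h₂, by simp [hs v h₁ h₂, h₃]⟩
  have hdvd : ϱ ∣ T - nextStop T s t := by simpa [hs _ htu huT] using hsu
  simp only [Phi, hlt, if_true, decide_eq_decide]
  constructor
  · intro h
    by_contra hnd
    have hpos : 0 < (T - t) % ϱ := Nat.pos_of_ne_zero fun h0 => hnd (Nat.dvd_of_mod_eq_zero h0)
    have hmod : (T - t) % ϱ < ϱ := Nat.mod_lt _ hϱ
    have hle : (T - t) % ϱ ≤ T - t := Nat.mod_le _ _
    have := hmin (t + (T - t) % ϱ) (by omega) (by omega)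
      (by rw [← Nat.sub_sub]; exact Nat.dvd_sub_mod _)
    omega
  · intro h
    refine Nat.le_of_dvd (by omega) ?_
    have := Nat.dvd_sub h hdvd
    rwa [show T - t - (T - nextStop T s t) = nextStop T s t - t by omega] at this

/-- Fix an integer horizon `T ≥ 1` and an integer `ϱ ≥ 2`.  The strategy `s*` defined by
`s*(t) = 1` iff `ϱ` divides `T − t` is the unique fixed point of the training operator `Φ`
among pure stopping strategies (functions `s : {0,…,T} → {0,1}` with `s T = 1`); this fixed
point is the sophisticated strategy of the immediate-cost problem. -/
theorem sophisticated_is_unique_fixed_point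
    (T ϱ : ℕ) (hT : 1 ≤ T) (hϱ : 2 ≤ ϱ) :
    (∀ t : ℕ, t ≤ T →
      Phi T ϱ (fun u => decide (ϱ ∣ (T - u))) t = decide (ϱ ∣ (T - t))) ∧
    (∀ s : ℕ → Bool, s T = true → (∀ t : ℕ, t ≤ T → Phi T ϱ s t = s t) →
      ∀ t : ℕ, t ≤ T → s t = decide (ϱ ∣ (T - t))) := by
  refine ⟨fun t ht => Phi_eq_of_agree_after (by omega) ht fun _ _ _ => rfl, ?_⟩
  intro s _ hfix t ht
  induction hn : T - t using Nat.strong_induction_on generalizing t with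
  | _ n ih =>
    rw [← hn, ← hfix t ht]
    exact Phi_eq_of_agree_after (by omega) ht fun u htu huT => ih (T - u) (by omega) u huT rfl
end

section
/- Let ω = ⌈(T+1)/ϱ⌉. For every integer m with 0 ≤ m ≤ ω − 1 and every t with 0 ≤ t ≤ T, the 2m-fold iterate satisfies Φ^{2m}(δ_T)(t) = 1 if and only if T − t = i·ϱ for some integer i with 0 ≤ i ≤ m. -/
/-- For `s` stopping at `T`, the strategy `Φ(s)` stops at `t < T` iff no stopping time of `s` lies
strictly between `t` and `t + ϱ`. -/
theorem Phi_eq_true_iff {T ϱ t : ℕ} {s : ℕ → Bool} (ht : t < T) (hs : s T = true) :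
    Phi T ϱ s t = true ↔ ∀ u, t < u → u ≤ T → s u = true → t + ϱ ≤ u := by
  have hne : {u : ℕ | t < u ∧ u ≤ T ∧ s u = true}.Nonempty := ⟨T, ht, le_rfl, hs⟩
  have hmem := Nat.sInf_mem hne
  rw [Phi, if_pos ht, decide_eq_true_iff, nextStop]
  constructor
  · intro h u h1 h2 h3
    have hle := Nat.sInf_le (show u ∈ {u : ℕ | t < u ∧ u ≤ T ∧ s u = true} from ⟨h1, h2, h3⟩)
    have := hmem.1
    omega
  · intro h
    have := h _ hmem.1 hmem.2.1 hmem.2.2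
    omega

/-- If no multiple `i * ϱ` with `i ≤ m` lies strictly between `d - ϱ` and `d`, then `d` is itself
such a multiple, up to `i = m + 1`. -/
theorem exists_eq_mul_of_gap {ϱ m d : ℕ} (hϱ : 0 < ϱ) (hd : 0 < d) (hdm : d ≤ (m + 1) * ϱ)
    (h : ∀ i ≤ m, i * ϱ < d → i * ϱ + ϱ ≤ d) : ∃ i ≤ m + 1, d = i * ϱ := by
  have hq : (d - 1) / ϱ < m + 1 := (Nat.div_lt_iff_lt_mul hϱ).2 (by omega)
  have h1 := Nat.div_mul_le_self (d - 1) ϱ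
  have h2 := Nat.lt_div_mul_add (a := d - 1) hϱ
  have h3 := h ((d - 1) / ϱ) (by omega) (by omega)
  refine ⟨(d - 1) / ϱ + 1, by omega, ?_⟩
  rw [Nat.add_mul, Nat.one_mul]
  omega

theorem mul_add_le_mul_of_mul_lt {ϱ i j : ℕ} (h : j * ϱ < i * ϱ) : j * ϱ + ϱ ≤ i * ϱ := by
  have h1 : j + 1 ≤ i := Nat.lt_of_mul_lt_mul_right h
  simpa [Nat.add_mul] using Nat.mul_le_mul_right ϱ h1

theorem Phi_of_multiples {T ϱ m : ℕ} {s : ℕ → Bool} (hϱ : 0 < ϱ)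
    (hs : ∀ t ≤ T, (s t = true ↔ ∃ i ≤ m, T - t = i * ϱ)) :
    ∀ t ≤ T, (Phi T ϱ s t = true ↔ (∃ i ≤ m, T - t = i * ϱ) ∨ (m + 1) * ϱ ≤ T - t) := by
  intro t ht
  rcases ht.eq_or_lt with rfl | ht
  · simpa [Phi] using Or.inl ⟨0, by simp⟩
  rw [Phi_eq_true_iff ht ((hs T le_rfl).2 ⟨0, by simp⟩)]
  constructor
  · intro h
    by_contra! hc
    obtain ⟨hc, hlt⟩ := hc
    obtain ⟨i, hi, hdi⟩ := exists_eq_mul_of_gap (m := m) hϱ (Nat.sub_pos_of_lt ht) hlt.le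
      fun i hi hlt => by
        have := h (T - i * ϱ) (by omega) (by omega) ((hs _ (by omega)).2 ⟨i, hi, by omega⟩)
        omega
    have : i < m + 1 := Nat.lt_of_mul_lt_mul_right (hdi ▸ hlt)
    exact hc i (by omega) hdi
  · rintro h u h1 h2 h3
    obtain ⟨j, hj, huj⟩ := (hs u h2).1 h3
    rcases h with ⟨i, -, hdi⟩ | hd
    · have := mul_add_le_mul_of_mul_lt (ϱ := ϱ) (i := i) (j := j) (by omega)
      omega
    · have := mul_add_le_mul_of_mul_lt (ϱ := ϱ) (i := m + 1) (j := j)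
        (Nat.mul_lt_mul_of_pos_right (by omega) hϱ)
      omega

theorem Phi_of_multiples_or_ge {T ϱ m : ℕ} {s : ℕ → Bool} (hϱ : 2 ≤ ϱ)
    (hs : ∀ t ≤ T, (s t = true ↔ (∃ i ≤ m, T - t = i * ϱ) ∨ (m + 1) * ϱ ≤ T - t)) :
    ∀ t ≤ T, (Phi T ϱ s t = true ↔ ∃ i ≤ m + 1, T - t = i * ϱ) := by
  intro t ht
  rcases ht.eq_or_lt with rfl | ht
  · simpa [Phi] using ⟨0, by simp⟩
  rw [Phi_eq_true_iff ht ((hs T le_rfl).2 (Or.inl ⟨0, by simp⟩))]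
  constructor
  · intro h
    refine exists_eq_mul_of_gap (by omega) (Nat.sub_pos_of_lt ht) ?_ fun i hi hlt => ?_
    · by_contra! hc
      have := h (t + 1) (by omega) (by omega) ((hs _ (by omega)).2 (Or.inr (by omega)))
      omega
    · have := h (T - i * ϱ) (by omega) (by omega)
        ((hs _ (by omega)).2 (Or.inl ⟨i, hi, by omega⟩))
      omega
  · rintro ⟨i, hi, hdi⟩ u h1 h2 h3
    rcases (hs u h2).1 h3 with ⟨j, -, huj⟩ | hu
    · have := mul_add_le_mul_of_mul_lt (ϱ := ϱ) (i := i) (j := j) (by omega)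
      omega
    · have := Nat.mul_le_mul_right ϱ hi
      omega

/-- Fix an integer horizon `T ≥ 1` and an integer `ϱ ≥ 2`, let `δ_T` be the strategy with
`δ_T(t) = 1` iff `t = T`, and let `ω = ⌈(T+1)/ϱ⌉` (ceiling division).  For every integer
`m` with `0 ≤ m ≤ ω − 1` and every `t` with `0 ≤ t ≤ T`, the `2m`-fold iterate satisfies
`Φ^{2m}(δ_T)(t) = 1` if and only if `T − t = i·ϱ` for some integer `i` with `0 ≤ i ≤ m`. -/
theorem even_iterates_of_training
    (T ϱ : ℕ) (hT : 1 ≤ T) (hϱ : 2 ≤ ϱ) (ω : ℕ) (hω : ω = (T + 1 + ϱ - 1) / ϱ) :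
    ∀ m : ℕ, m ≤ ω - 1 → ∀ t : ℕ, t ≤ T →
      ((Phi T ϱ)^[2 * m] (fun u => decide (u = T)) t = true ↔
        ∃ i : ℕ, i ≤ m ∧ T - t = i * ϱ) := by
  intro m _
  clear * - hϱ
  induction m with
  | zero =>
    intro t ht
    simp
    omega
  | succ m ih =>
    rw [Nat.mul_succ, Function.iterate_succ_apply', Function.iterate_succ_apply']
    exact Phi_of_multiples_or_ge hϱ (Phi_of_multiples (by omega) ih)
end

section
/- Let ω = ⌈(T+1)/ϱ⌉. Then the naive strategy δ_T is trained into the sophisticated strategy after 2(ω − 1) rounds: Φ^{2(ω−1)}(δ_T) = s*, where s*(t) = 1 if and only if ϱ divides T − t; moreover s* is a fixed point of Φ, so all further rounds leave the strategy unchanged. -/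
theorem nextStop_eq_of_isFirst {T t v : ℕ} {s : ℕ → Bool} (htv : t < v) (hv : v ≤ T)
    (hs : s v = true) (hfirst : ∀ u, t < u → u < v → s u = false) : nextStop T s t = v := by
  refine IsLeast.csInf_eq ⟨⟨htv, hv, hs⟩, fun u ⟨h1, _, h3⟩ => ?_⟩
  by_contra! h
  simp [hfirst u h1 h] at h3

/-- The value of `Phi` in terms of the distance `e` from the horizon to the next stop. -/
theorem Phi_eq_of_isFirst {T ϱ t e : ℕ} {s : ℕ → Bool} (he : e < T - t)
    (hs : s (T - e) = true) (hfirst : ∀ e', e < e' → e' < T - t → s (T - e') = false) :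
    Phi T ϱ s t = decide (ϱ ≤ T - t - e) := by
  have hnext : nextStop T s t = T - e := by
    refine nextStop_eq_of_isFirst (by omega) (by omega) hs fun u h1 h2 => ?_
    have := hfirst (T - u) (by omega) (by omega)
    rwa [Nat.sub_sub_self (by omega)] at this
  rw [Phi, if_pos (by omega), hnext, Nat.sub_right_comm]

theorem Nat.exists_eq_mul_add_pos {ϱ d : ℕ} (hϱ : 0 < ϱ) (hd : 0 < d) :
    ∃ q r, d = q * ϱ + r ∧ 0 < r ∧ r ≤ ϱ := by
  refine ⟨(d - 1) / ϱ, (d - 1) % ϱ + 1, ?_, by omega, Nat.mod_lt _ hϱ⟩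
  have := Nat.div_add_mod' (d - 1) ϱ
  omega

theorem Nat.not_dvd_of_mul_lt_of_lt {ϱ q e : ℕ} (h1 : q * ϱ < e) (h2 : e < q * ϱ + ϱ) :
    ¬ ϱ ∣ e := by
  rintro ⟨c, rfl⟩
  have h3 : q < c := by
    by_contra! h
    nlinarith
  nlinarith

theorem Nat.dvd_mul_add_iff_le {ϱ q r : ℕ} (hr : 0 < r) (hrϱ : r ≤ ϱ) :
    ϱ ∣ q * ϱ + r ↔ ϱ ≤ r := by
  rw [Nat.dvd_add_right (Nat.dvd_mul_left ϱ q)]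
  exact ⟨Nat.le_of_dvd hr, fun h => (le_antisymm hrϱ h) ▸ dvd_rfl⟩

/-- Training a strategy that stops at distances `0, ϱ, …, k * ϱ` from the horizon adds all
distances from `(k + 1) * ϱ` on. -/
theorem Phi_of_stops_up_to {T ϱ k : ℕ} {s : ℕ → Bool} (hϱ : 0 < ϱ)
    (hs : ∀ t ≤ T, s t = decide (ϱ ∣ T - t ∧ T - t ≤ k * ϱ)) (t : ℕ) (ht : t ≤ T) :
    Phi T ϱ s t = decide ((ϱ ∣ T - t ∧ T - t ≤ k * ϱ) ∨ (k + 1) * ϱ ≤ T - t) := by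
  obtain rfl | hlt := ht.eq_or_lt
  · simp [Phi]
  obtain ⟨q, r, hd, hr, hrϱ⟩ := Nat.exists_eq_mul_add_pos hϱ (Nat.sub_pos_of_lt hlt)
  rcases lt_or_ge q k with hq | hq
  · have hqk : q * ϱ + ϱ ≤ k * ϱ := by nlinarith
    rw [Phi_eq_of_isFirst (e := q * ϱ) (by omega)]
    · rw [decide_eq_decide, hd, Nat.dvd_mul_add_iff_le hr hrϱ, add_mul]
      omega
    · rw [hs _ (by omega), Nat.sub_sub_self (by omega), decide_eq_true_iff]
      exact ⟨Nat.dvd_mul_left _ _, by omega⟩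
    · intro e h1 h2
      rw [hs _ (by omega), Nat.sub_sub_self (by omega), decide_eq_false_iff_not]
      exact fun h => Nat.not_dvd_of_mul_lt_of_lt h1 (by omega) h.1
  · have hqk : k * ϱ ≤ q * ϱ := Nat.mul_le_mul_right _ hq
    rw [Phi_eq_of_isFirst (e := k * ϱ) (by omega)]
    · rw [decide_eq_decide, add_mul]
      omega
    · rw [hs _ (by omega), Nat.sub_sub_self (by omega), decide_eq_true_iff]
      exact ⟨Nat.dvd_mul_left _ _, le_rfl⟩
    · intro e h1 h2
      rw [hs _ (by omega), Nat.sub_sub_self (by omega), decide_eq_false_iff_not]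
      omega

/-- Training a strategy that stops at distances `0, ϱ, …, k * ϱ` and all distances from
`(k + 1) * ϱ` on leaves the stops `0, ϱ, …, (k + 1) * ϱ`. -/
theorem Phi_of_stops_up_to_or_ge {T ϱ k : ℕ} {s : ℕ → Bool} (hϱ : 2 ≤ ϱ)
    (hs : ∀ t ≤ T, s t = decide ((ϱ ∣ T - t ∧ T - t ≤ k * ϱ) ∨ (k + 1) * ϱ ≤ T - t))
    (t : ℕ) (ht : t ≤ T) :
    Phi T ϱ s t = decide (ϱ ∣ T - t ∧ T - t ≤ (k + 1) * ϱ) := by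
  obtain rfl | hlt := ht.eq_or_lt
  · simp [Phi]
  obtain ⟨q, r, hd, hr, hrϱ⟩ :=
    Nat.exists_eq_mul_add_pos (by omega : 0 < ϱ) (Nat.sub_pos_of_lt hlt)
  rcases le_or_gt (T - t) ((k + 1) * ϱ) with hle | hgt
  · have hqk : q ≤ k := by
      by_contra! h
      nlinarith
    have hqk' : q * ϱ ≤ k * ϱ := Nat.mul_le_mul_right _ hqk
    rw [Phi_eq_of_isFirst (e := q * ϱ) (by omega)]
    · rw [decide_eq_decide, and_iff_left hle, hd, Nat.dvd_mul_add_iff_le hr hrϱ]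
      omega
    · rw [hs _ (by omega), Nat.sub_sub_self (by omega), decide_eq_true_iff]
      exact Or.inl ⟨Nat.dvd_mul_left _ _, hqk'⟩
    · intro e h1 h2
      rw [hs _ (by omega), Nat.sub_sub_self (by omega), decide_eq_false_iff_not]
      have := Nat.not_dvd_of_mul_lt_of_lt h1 (by omega)
      omega
  · rw [Phi_eq_of_isFirst (e := T - t - 1) (by omega)]
    · rw [decide_eq_decide]
      omega
    · rw [hs _ (by omega), Nat.sub_sub_self (by omega), decide_eq_true_iff]
      omega
    · intro e h1 h2
      omega

theorem Phi_iterate_two_mul {T ϱ : ℕ} (hϱ : 2 ≤ ϱ) (k : ℕ) : ∀ t ≤ T,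
    (Phi T ϱ)^[2 * k] (fun u => decide (u = T)) t =
      decide (ϱ ∣ T - t ∧ T - t ≤ k * ϱ) := by
  induction k with
  | zero =>
    intro t ht
    simp only [mul_zero, Function.iterate_zero, id_eq, zero_mul, decide_eq_decide]
    constructor
    · rintro rfl
      simp
    · omega
  | succ k ih =>
    intro t ht
    rw [mul_add_one, Function.iterate_succ_apply', Function.iterate_succ_apply']
    exact Phi_of_stops_up_to_or_ge hϱ (Phi_of_stops_up_to (by omega) ih) t ht

/-- Fix an integer horizon `T ≥ 1` and an integer `ϱ ≥ 2`, let `δ_T` be the strategy with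
`δ_T(t) = 1` iff `t = T`, and let `ω = ⌈(T+1)/ϱ⌉` (ceiling division).  Then the naive
strategy `δ_T` is trained into the sophisticated strategy after `2(ω−1)` rounds:
`Φ^{2(ω−1)}(δ_T) = s*`, where `s*(t) = 1` iff `ϱ ∣ (T − t)`; moreover `s*` is a fixed
point of `Φ`, so all further rounds leave the strategy unchanged. -/
theorem training_reaches_sophisticated_immediate_cost
    (T ϱ : ℕ) (hT : 1 ≤ T) (hϱ : 2 ≤ ϱ) (ω : ℕ) (hω : ω = (T + 1 + ϱ - 1) / ϱ) :
    (∀ t : ℕ, t ≤ T →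
      (Phi T ϱ)^[2 * (ω - 1)] (fun u => decide (u = T)) t = decide (ϱ ∣ (T - t))) ∧
    (∀ t : ℕ, t ≤ T →
      Phi T ϱ (fun u => decide (ϱ ∣ (T - u))) t = decide (ϱ ∣ (T - t))) := by
  have hϱ0 : 0 < ϱ := by omega
  refine ⟨fun t ht => ?_, fun t ht => ?_⟩
  · have hω' : ω - 1 = T / ϱ := by
      rw [hω, show T + 1 + ϱ - 1 = T + ϱ by omega, Nat.add_div_right _ hϱ0, Nat.succ_sub_one]
    rw [Phi_iterate_two_mul hϱ _ t ht, hω', decide_eq_decide, and_iff_left_iff_imp]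
    rintro ⟨c, hc⟩
    rw [hc, mul_comm]
    refine Nat.mul_le_mul_right _ ((Nat.le_div_iff_mul_le hϱ0).2 ?_)
    rw [mul_comm, ← hc]
    exact Nat.sub_le T t
  · have hle : T ≤ T * ϱ := Nat.le_mul_of_pos_right T hϱ0
    rw [Phi_of_stops_up_to (k := T) hϱ0 _ t ht, decide_eq_decide, add_mul]
    · omega
    · intro u _
      rw [decide_eq_decide]
      omega
end

section
/- If β > θ, then for every time t with 0 ≤ t < T, the plan δ_{T−t} that stops at the terminal time T for sure (p_{T−t} = 1, all other p_j = 0) is the unique maximizer of V_t over all randomized stopping plans at time t; that is, it is optimal to stop as late as possible, and the naive strategy of stopping only at time T coincides with the sophisticated strategy. -/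
/-- Present-biased preference value with immediate reward: for a randomized stopping plan
`p = (p 0, …, p (T-t))` at time `t`,
`V_t(p) = θ^{−t}·(θ^T v·p 0 + Σ_{j=1}^{T−t} β θ^{T−j} v·p j)`. -/
noncomputable def rewardVal (T : ℕ) (v θ β : ℝ) (t : ℕ) (p : ℕ → ℝ) : ℝ :=
  (θ ^ t)⁻¹ * (θ ^ T * v * p 0 + ∑ j ∈ Finset.Icc 1 (T - t), β * θ ^ (T - j) * v * p j)

/-- A linear functional on the standard simplex whose largest coefficient is attained only at the
index `n` is uniquely maximized at the vertex `n`. -/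
theorem sum_mul_le_and_eq_vertex_of_lt {n : ℕ} {c p : ℕ → ℝ} (hc : ∀ j < n, c j < c n)
    (hp : ∀ j ≤ n, 0 ≤ p j) (hsum : ∑ j ∈ Finset.range (n + 1), p j = 1) :
    ∑ j ∈ Finset.range (n + 1), c j * p j ≤ c n ∧
      (∑ j ∈ Finset.range (n + 1), c j * p j = c n →
        ∀ j ≤ n, p j = if j = n then 1 else 0) := by
  have hgap : c n - ∑ j ∈ Finset.range (n + 1), c j * p j
      = ∑ j ∈ Finset.range n, (c n - c j) * p j := by
    rw [Finset.sum_range_succ] at hsum ⊢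
    simp only [sub_mul, Finset.sum_sub_distrib, ← Finset.mul_sum]
    linear_combination -c n * hsum
  have hnonneg : ∀ j ∈ Finset.range n, 0 ≤ (c n - c j) * p j := fun j hj =>
    have hj := Finset.mem_range.1 hj
    mul_nonneg (sub_nonneg.2 (hc j hj).le) (hp j hj.le)
  refine ⟨by linarith [Finset.sum_nonneg hnonneg], fun heq => ?_⟩
  rw [heq, sub_self, eq_comm, Finset.sum_eq_zero_iff_of_nonneg hnonneg] at hgap
  have hzero : ∀ j < n, p j = 0 := fun j hj =>
    (mul_eq_zero.1 (hgap j (Finset.mem_range.2 hj))).resolve_left (sub_pos.2 (hc j hj)).ne'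
  intro j hj
  split_ifs with hjn
  · rwa [Finset.sum_range_succ,
      Finset.sum_eq_zero fun i hi => hzero i (Finset.mem_range.1 hi), zero_add, ← hjn] at hsum
  · exact hzero j (lt_of_le_of_ne hj hjn)

/-- The weight that `rewardVal` puts on stopping at time `t + j`. -/
noncomputable def rewardCoeff (T : ℕ) (v θ β : ℝ) (t j : ℕ) : ℝ :=
  (θ ^ t)⁻¹ * (if j = 0 then θ ^ T * v else β * θ ^ (T - j) * v)

theorem rewardVal_eq_sum_rewardCoeff (T : ℕ) (v θ β : ℝ) (t : ℕ) (p : ℕ → ℝ) :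
    rewardVal T v θ β t p
      = ∑ j ∈ Finset.range (T - t + 1), rewardCoeff T v θ β t j * p j := by
  rw [rewardVal, Finset.range_eq_Ico, Finset.sum_eq_sum_Ico_succ_bot (Nat.succ_pos _), mul_add,
    Finset.mul_sum]
  congr 1
  · simp [rewardCoeff, mul_assoc]
  · refine Finset.sum_congr rfl fun j hj => ?_
    have hj : j ≠ 0 := by have := (Finset.mem_Ico.1 hj).1; omega
    simp [rewardCoeff, hj, mul_assoc]

theorem rewardCoeff_lt_terminal {T : ℕ} {v θ β : ℝ} (hv : 0 < v) (hθ0 : 0 < θ) (hθ1 : θ < 1)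
    (h : θ < β) {t : ℕ} (ht : t < T) {j : ℕ} (hj : j < T - t) :
    rewardCoeff T v θ β t j < rewardCoeff T v θ β t (T - t) := by
  have hβ0 : 0 < β := hθ0.trans h
  rw [rewardCoeff, rewardCoeff, if_neg (by omega : T - t ≠ 0), Nat.sub_sub_self ht.le]
  refine mul_lt_mul_of_pos_left ?_ (by positivity)
  split_ifs
  · refine mul_lt_mul_of_pos_right ?_ hv
    calc θ ^ T ≤ θ ^ (t + 1) := pow_le_pow_of_le_one hθ0.le hθ1.le ht
      _ = θ * θ ^ t := pow_succ' θ t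
      _ < β * θ ^ t := mul_lt_mul_of_pos_right h (by positivity)
  · refine mul_lt_mul_of_pos_right (mul_lt_mul_of_pos_left ?_ hβ0) hv
    exact pow_lt_pow_right_of_lt_one₀ hθ0 hθ1 (by omega)

/-- Fix an integer horizon `T ≥ 1` and reals `v > 0`, `θ ∈ (0,1)`, `β ∈ (0,1]`.
If `β > θ`, then for every time `0 ≤ t < T`, the plan `δ_{T−t}` that stops at the terminal
time `T` for sure is the unique maximizer of `V_t` over all randomized stopping plans at
time `t`: it is optimal to stop as late as possible, and the naive strategy of stopping
only at time `T` coincides with the sophisticated strategy. -/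
theorem immediate_reward_stop_late_unique
    (T : ℕ) (hT : 1 ≤ T) (v θ β : ℝ) (hv : 0 < v)
    (hθ0 : 0 < θ) (hθ1 : θ < 1) (hβ0 : 0 < β) (hβ1 : β ≤ 1)
    (h : θ < β) :
    ∀ t : ℕ, t < T → ∀ p : ℕ → ℝ,
      (∀ j : ℕ, j ≤ T - t → 0 ≤ p j) →
      (∑ j ∈ Finset.range (T - t + 1), p j) = 1 →
      (rewardVal T v θ β t p ≤ rewardVal T v θ β t (fun j => if j = T - t then 1 else 0) ∧
       (rewardVal T v θ β t p = rewardVal T v θ β t (fun j => if j = T - t then 1 else 0) →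
         ∀ j : ℕ, j ≤ T - t → p j = if j = T - t then 1 else 0)) := by
  intro t ht p hp hsum
  have hδ : rewardVal T v θ β t (fun j => if j = T - t then 1 else 0)
      = rewardCoeff T v θ β t (T - t) := by
    simp [rewardVal_eq_sum_rewardCoeff]
  rw [hδ, rewardVal_eq_sum_rewardCoeff]
  exact sum_mul_le_and_eq_vertex_of_lt
    (fun _ hj => rewardCoeff_lt_terminal hv hθ0 hθ1 h ht hj) hp hsum
end

section
/- For every integer m ≥ 0 and every t with 0 ≤ t ≤ T, the m-fold iterate satisfies Ψ^m(n⁰)(t) = 1 if and only if T − t ≤ (m+1)·ν; that is, each round of training extends the block of stopping times backward by ν periods. -/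
/-- The training operator `Ψ` of the immediate-reward problem: `Ψ(s)(T) = 1` and, for
`t < T`, `Ψ(s)(t) = 1` if `σ_s(t) − t ≤ ν` and `Ψ(s)(t) = 0` otherwise. -/
noncomputable def Psi (T ν : ℕ) (s : ℕ → Bool) : ℕ → Bool :=
  fun t => if t < T then decide (nextStop T s t - t ≤ ν) else true

/-- If `s` stops exactly in the last `k` periods before `T`, its first stopping time after
`t < T` is `max (t + 1) (T - k)`. -/
theorem nextStop_eq_max {T k t : ℕ} {s : ℕ → Bool}
    (hs : ∀ u ≤ T, (s u = true ↔ T - u ≤ k)) (ht : t < T) :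
    nextStop T s t = max (t + 1) (T - k) := by
  have hleast : IsLeast {u : ℕ | t < u ∧ u ≤ T ∧ s u = true} (max (t + 1) (T - k)) := by
    refine ⟨⟨by omega, by omega, (hs _ (by omega)).2 (by omega)⟩, ?_⟩
    rintro u ⟨htu, huT, hu⟩
    have := (hs u huT).1 hu
    omega
  exact hleast.csInf_eq

/-- One round of training extends a terminal block of stopping times backward by `ν` periods. -/
theorem Psi_eq_true_iff {T ν k : ℕ} {s : ℕ → Bool} (hν : 1 ≤ ν)
    (hs : ∀ u ≤ T, (s u = true ↔ T - u ≤ k)) {t : ℕ} (ht : t ≤ T) :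
    Psi T ν s t = true ↔ T - t ≤ k + ν := by
  rcases ht.lt_or_eq with h | rfl
  · simp only [Psi, if_pos h, nextStop_eq_max hs h, decide_eq_true_eq]
    omega
  · simp [Psi]

/-- Fix an integer horizon `T ≥ 1` and an integer `ν` with `1 ≤ ν ≤ T−1`, and let `n⁰` be the
naive actual strategy, `n⁰(t) = 1` iff `T − t ≤ ν`.  For every integer `m ≥ 0` and every
`t` with `0 ≤ t ≤ T`, the `m`-fold iterate satisfies `Ψ^m(n⁰)(t) = 1` iff
`T − t ≤ (m+1)·ν`: each round of training extends the block of stopping times backward by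
`ν` periods. -/
theorem iterates_of_training_immediate_reward
    (T ν : ℕ) (hT : 1 ≤ T) (hν1 : 1 ≤ ν) (hν2 : ν ≤ T - 1) :
    ∀ m : ℕ, ∀ t : ℕ, t ≤ T →
      ((Psi T ν)^[m] (fun u => decide (T - u ≤ ν)) t = true ↔ T - t ≤ (m + 1) * ν) := by
  intro m
  induction m with
  | zero => simp
  | succ m ih =>
    intro t ht
    rw [Function.iterate_succ_apply', Psi_eq_true_iff hν1 ih ht, Nat.succ_mul (m + 1)]
end

section
/- The all-ones strategy 𝟙, defined by 𝟙(t) = 1 for every t with 0 ≤ t ≤ T, is the unique fixed point of the training operator Ψ among pure stopping strategies, and the naive strategy is trained into it after ⌈T/ν⌉ rounds: Ψ^{⌈T/ν⌉}(n⁰) = 𝟙. -/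
theorem nextStop_le {T : ℕ} {s : ℕ → Bool} {t u : ℕ} (htu : t < u) (huT : u ≤ T)
    (hu : s u = true) : nextStop T s t ≤ u :=
  Nat.sInf_le ⟨htu, huT, hu⟩

/-- `Ψ(s)` stops at `t` whenever `s` stops at some time in `(t, min (t + ν) T]`. -/
theorem Psi_eq_true_of_stop {T ν : ℕ} {s : ℕ → Bool} {t u : ℕ} (htu : t < u) (huT : u ≤ T)
    (huν : u ≤ t + ν) (hu : s u = true) : Psi T ν s t = true := by
  have h := nextStop_le htu huT hu
  rw [Psi, if_pos (htu.trans_le huT), decide_eq_true_iff]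
  omega

theorem Psi_self (T ν : ℕ) (s : ℕ → Bool) : Psi T ν s T = true := by
  simp [Psi]

/-- One round of training extends a final segment of stopping times by `ν`. -/
theorem Psi_eq_true_of_final_segment {T ν a : ℕ} (hν : 1 ≤ ν) {s : ℕ → Bool}
    (hs : ∀ t ≤ T, T ≤ t + a → s t = true) :
    ∀ t ≤ T, T ≤ t + (a + ν) → Psi T ν s t = true := by
  intro t ht hta
  rcases ht.eq_or_lt with rfl | hlt
  · exact Psi_self t ν s
  · exact Psi_eq_true_of_stop (u := min (t + ν) T) (by omega) (by omega) (by omega)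
      (hs _ (by omega) (by omega))

theorem iterate_Psi_eq_true_of_final_segment {T ν a : ℕ} (hν : 1 ≤ ν) {s : ℕ → Bool}
    (hs : ∀ t ≤ T, T ≤ t + a → s t = true) (m : ℕ) :
    ∀ t ≤ T, T ≤ t + (a + m * ν) → (Psi T ν)^[m] s t = true := by
  induction m with
  | zero => simpa using hs
  | succ m ih =>
    rw [Function.iterate_succ_apply', Nat.succ_mul, ← Nat.add_assoc]
    exact Psi_eq_true_of_final_segment hν ih

/-- Fix an integer horizon `T ≥ 1` and an integer `ν` with `1 ≤ ν ≤ T−1`, and let `n⁰` be the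
naive actual strategy, `n⁰(t) = 1` iff `T − t ≤ ν`.  The all-ones strategy `𝟙`
(`𝟙(t) = 1` for every `0 ≤ t ≤ T`) is the unique fixed point of the training operator `Ψ`
among pure stopping strategies (functions `s : {0,…,T} → {0,1}` with `s T = 1`), and the
naive strategy is trained into it after `⌈T/ν⌉` rounds: `Ψ^{⌈T/ν⌉}(n⁰) = 𝟙`. -/
theorem all_ones_unique_fixed_point_and_training
    (T ν : ℕ) (hT : 1 ≤ T) (hν1 : 1 ≤ ν) (hν2 : ν ≤ T - 1) :
    (∀ t : ℕ, t ≤ T → Psi T ν (fun _ => true) t = true) ∧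
    (∀ s : ℕ → Bool, s T = true → (∀ t : ℕ, t ≤ T → Psi T ν s t = s t) →
      ∀ t : ℕ, t ≤ T → s t = true) ∧
    (∀ t : ℕ, t ≤ T →
      (Psi T ν)^[(T + ν - 1) / ν] (fun u => decide (T - u ≤ ν)) t = true) := by
  refine ⟨fun t ht => ?_, fun s hsT hfix t ht => ?_, fun t ht => ?_⟩
  · exact Psi_eq_true_of_final_segment (a := T) hν1 (fun _ _ _ => rfl) t ht (by omega)
  · induction ht using Nat.decreasingInduction with
    | self => exact hsT
    | @of_succ t ht ih =>
      rw [← hfix t ht.le]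
      exact Psi_eq_true_of_stop t.lt_succ_self ht (by omega) ih
  · refine iterate_Psi_eq_true_of_final_segment (a := ν) hν1 ?_ _ t ht ?_
    · intro u _ hu
      rw [decide_eq_true_iff]
      omega
    · have h := Nat.lt_div_mul_add (a := T + ν - 1) hν1
      omega
end
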